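/- arXiv:1206.4395 — 2 statements merged into one kernel-verified Lean document; each statement's English description precedes it below -/
import Mathlib

section
/- For a traceless 3×3 complex matrix A, define I₅(A) = (A₁₁−A₂₂)A₃₂A₃₁ + A₂₁A₃₂² − A₃₁²A₁₂. Then for every g ∈ SL(2,ℂ) and every traceless 3×3 complex matrix A, I₅(u(g)·A·u(g)⁻¹) = I₅(A), where u(g) ∈ SL(3,ℂ) is the block-diagonal matrix with upper-left 2×2 block g and lower-right entry 1. -/
open Matrix

/-- The embedding `g ↦ u(g) = diag(g,1)` of `SL(2,ℂ)` into the `3×3` matrices. -/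
def u (g : Matrix.SpecialLinearGroup (Fin 2) ℂ) : Matrix (Fin 3) (Fin 3) ℂ :=
  !![(g : Matrix (Fin 2) (Fin 2) ℂ) 0 0, (g : Matrix (Fin 2) (Fin 2) ℂ) 0 1, 0;
     (g : Matrix (Fin 2) (Fin 2) ℂ) 1 0, (g : Matrix (Fin 2) (Fin 2) ℂ) 1 1, 0;
     0, 0, 1]

/-- The invariant `I₅ = h₁x₂x₃ + x₁x₂² − x₃²y₁`. -/
def I₅ (A : Matrix (Fin 3) (Fin 3) ℂ) : ℂ :=
  (A 0 0 - A 1 1) * A 2 1 * A 2 0 + A 1 0 * A 2 1 ^ 2 - A 2 0 ^ 2 * A 0 1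

theorem u_mul_u_inv (g : Matrix.SpecialLinearGroup (Fin 2) ℂ) : u g * u g⁻¹ = 1 := by
  have h := g.det_coe
  rw [Matrix.det_fin_two] at h
  ext i j
  fin_cases i <;> fin_cases j <;>
    simp [u, Matrix.mul_apply, Fin.sum_univ_three, Matrix.SpecialLinearGroup.coe_inv,
      Matrix.adjugate_fin_two] <;>
    first
      | ring1
      | linear_combination h

theorem inv_u (g : Matrix.SpecialLinearGroup (Fin 2) ℂ) : (u g)⁻¹ = u g⁻¹ :=
  Matrix.inv_eq_right_inv (u_mul_u_inv g)

/-- `I₅` is invariant under the adjoint action of the embedded `SL(2,ℂ)` on `sl(3,ℂ)`. -/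
theorem I5_invariant (g : Matrix.SpecialLinearGroup (Fin 2) ℂ)
    (A : Matrix (Fin 3) (Fin 3) ℂ) (hA : A.trace = 0) :
    I₅ (u g * A * (u g)⁻¹) = I₅ A := by
  have h := g.det_coe
  rw [Matrix.det_fin_two] at h
  rw [inv_u]
  simp only [I₅, u, Matrix.mul_apply, Fin.sum_univ_three, Matrix.SpecialLinearGroup.coe_inv,
    Matrix.adjugate_fin_two, Matrix.of_apply, Matrix.cons_val]
  linear_combination
    ((g : Matrix (Fin 2) (Fin 2) ℂ) 0 0 * (g : Matrix (Fin 2) (Fin 2) ℂ) 1 1 -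
      (g : Matrix (Fin 2) (Fin 2) ℂ) 0 1 * (g : Matrix (Fin 2) (Fin 2) ℂ) 1 0 + 1) *
      ((A 0 0 - A 1 1) * A 2 1 * A 2 0 + A 1 0 * A 2 1 ^ 2 - A 2 0 ^ 2 * A 0 1) * h
end

section
/- For a traceless 3×3 complex matrix A, define I₆(A) = (A₁₁−A₂₂)(A₃₂A₂₃ − A₃₁A₁₃) − 2(A₁₂A₂₃A₃₁ + A₂₁A₃₂A₁₃). Then for every g ∈ SL(2,ℂ) and every traceless 3×3 complex matrix A, I₆(u(g)·A·u(g)⁻¹) = I₆(A), where u(g) ∈ SL(3,ℂ) is the block-diagonal matrix with upper-left 2×2 block g and lower-right entry 1. -/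
open Matrix

/-- The invariant `I₆ = h₁(x₂y₂ − x₃y₃) − 2(y₁y₂x₃ + x₁x₂y₃)`. -/
def I₆ (A : Matrix (Fin 3) (Fin 3) ℂ) : ℂ :=
  (A 0 0 - A 1 1) * (A 2 1 * A 1 2 - A 2 0 * A 0 2) -
    2 * (A 0 1 * A 1 2 * A 2 0 + A 1 0 * A 2 1 * A 0 2)

/-- The embedding `u` sends inverses to inverses. -/
theorem u_inv (g : Matrix.SpecialLinearGroup (Fin 2) ℂ) :
    (u g)⁻¹ = !![(g : Matrix (Fin 2) (Fin 2) ℂ) 1 1, -(g : Matrix (Fin 2) (Fin 2) ℂ) 0 1, 0;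
      -(g : Matrix (Fin 2) (Fin 2) ℂ) 1 0, (g : Matrix (Fin 2) (Fin 2) ℂ) 0 0, 0;
      0, 0, 1] := by
  have hd := g.det_coe
  rw [Matrix.det_fin_two] at hd
  apply Matrix.inv_eq_right_inv
  ext i j
  fin_cases i <;> fin_cases j <;> simp [u, Matrix.mul_apply, Fin.sum_univ_three] <;>
    first
    | ring1
    | linear_combination hd

/-- `I₆` is invariant under the adjoint action of the embedded `SL(2,ℂ)` on `sl(3,ℂ)`. -/
theorem I6_invariant (g : Matrix.SpecialLinearGroup (Fin 2) ℂ)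
    (A : Matrix (Fin 3) (Fin 3) ℂ) (hA : A.trace = 0) :
    I₆ (u g * A * (u g)⁻¹) = I₆ A := by
  have hd := g.det_coe
  rw [Matrix.det_fin_two] at hd
  rw [u_inv]
  simp only [I₆, u, Matrix.mul_apply, Fin.sum_univ_three, Matrix.of_apply, Matrix.cons_val]
  generalize (g : Matrix (Fin 2) (Fin 2) ℂ) 0 0 = a at *
  generalize (g : Matrix (Fin 2) (Fin 2) ℂ) 0 1 = b at *
  generalize (g : Matrix (Fin 2) (Fin 2) ℂ) 1 0 = c at *
  generalize (g : Matrix (Fin 2) (Fin 2) ℂ) 1 1 = d at *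
  linear_combination (a * d - b * c + 1) *
    ((A 0 0 - A 1 1) * (A 2 1 * A 1 2 - A 2 0 * A 0 2) -
      2 * (A 0 1 * A 1 2 * A 2 0 + A 1 0 * A 2 1 * A 0 2)) * hd
end
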